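/- Let p > 2 be a prime, q a power of p, and n > 2. Then H¹(SL_n(𝔽_q), 𝔤𝔩_n(𝔽_q)) = 0, where SL_n(𝔽_q) acts on the matrix algebra 𝔤𝔩_n(𝔽_q) = M_n(𝔽_q) by conjugation. Equivalently: every map δ : SL_n(𝔽_q) → M_n(𝔽_q) satisfying the cocycle identity δ(gh) = δ(g) + g·δ(h)·g⁻¹ for all g, h ∈ SL_n(𝔽_q) is a coboundary, i.e., there exists m ∈ M_n(𝔽_q) such that δ(g) = m − g·m·g⁻¹ for all g ∈ SL_n(𝔽_q). -/

import Mathlib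

/-!
STATEMENT 4: `H¹(SL_n(𝔽_q), 𝔤𝔩_n(𝔽_q)) = 0` for p > 2, q a power of p, n > 2, in the
explicit form: every conjugation 1-cocycle `δ : SL_n(𝔽_q) → M_n(𝔽_q)` is a coboundary.
-/

noncomputable section
open Matrix

section aux

variable {n : ℕ} {F : Type} [Field F]


lemma tv_mul_apply {i j : Fin n} (h : i ≠ j) (v : F) (M : Matrix (Fin n) (Fin n) F) (a b : Fin n) :
    ((SpecialLinearGroup.transvection h v : Matrix.SpecialLinearGroup (Fin n) F) * M) a b = M a b + if a = i then v * M j b else 0 := by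
  rw [Matrix.SpecialLinearGroup.transvection_coe, Matrix.add_mul, Matrix.one_mul, Matrix.add_apply]
  congr 1
  split_ifs with h1
  · subst h1; simp
  · simp [h1]

lemma mul_tv_apply {i j : Fin n} (h : i ≠ j) (v : F) (M : Matrix (Fin n) (Fin n) F) (a b : Fin n) :
    (M * (SpecialLinearGroup.transvection h v : Matrix.SpecialLinearGroup (Fin n) F)) a b = M a b + if b = j then v * M a i else 0 := by
  rw [Matrix.SpecialLinearGroup.transvection_coe, Matrix.mul_add, Matrix.mul_one, Matrix.add_apply]
  congr 1
  split_ifs with h1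
  · subst h1; simp [mul_comm]
  · simp [h1]

lemma tv_inv_rel {i j : Fin n} (h : i ≠ j) (v : F) (Δ : Matrix.SpecialLinearGroup (Fin n) F → Matrix (Fin n) (Fin n) F)
    (hΔ : ∀ g h : Matrix.SpecialLinearGroup (Fin n) F, Δ (g * h) = Δ g * h + g * Δ h) (a b : Fin n) :
    (Δ (SpecialLinearGroup.transvection h v)) a b + (if b = j then (-v) * Δ (SpecialLinearGroup.transvection h v) a i else 0) +
     (Δ (SpecialLinearGroup.transvection h (-v)) a b + if a = i then v * Δ (SpecialLinearGroup.transvection h (-v)) j b else 0) = 0 := by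
  have h1 : Δ 1 = 0 := by
    have := hΔ 1 1
    simpa using this
  have := hΔ (SpecialLinearGroup.transvection h v) (SpecialLinearGroup.transvection h (-v))
  rw [Matrix.SpecialLinearGroup.transvection_mul_neg, h1] at this
  have := congrFun (congrFun this a) b
  rw [Matrix.add_apply, tv_mul_apply, mul_tv_apply] at this
  exact this.symm

lemma diag_rel {i j : Fin n} (h : i ≠ j) (v w : F) (Δ : Matrix.SpecialLinearGroup (Fin n) F → Matrix (Fin n) (Fin n) F)
    (hΔ : ∀ g h : Matrix.SpecialLinearGroup (Fin n) F, Δ (g * h) = Δ g * h + g * Δ h)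
    (t : Matrix.SpecialLinearGroup (Fin n) F) (D : Fin n → F) (ht : (t : Matrix (Fin n) (Fin n) F) = diagonal D) (h0 : Δ t = 0)
    (hD : D i * v = w * D j) (k l : Fin n) :
    D k * Δ (SpecialLinearGroup.transvection h v) k l = Δ (SpecialLinearGroup.transvection h w) k l * D l := by
  have e : t * SpecialLinearGroup.transvection h v = SpecialLinearGroup.transvection h w * t := by
    apply Subtype.ext
    rw [Matrix.SpecialLinearGroup.coe_mul, Matrix.SpecialLinearGroup.coe_mul]
    ext a b
    rw [tv_mul_apply, mul_tv_apply, ht]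
    congr 1
    by_cases hb : b = j <;> by_cases ha : a = i
    · subst hb ha; simp [mul_comm v, hD]
    · simp [ha]
    · simp [hb, Ne.symm hb]
    · simp [ha, hb]
  have e2 := congrArg Δ e
  rw [hΔ, hΔ, h0] at e2
  have := congrFun (congrFun e2 k) l
  simpa [ht] using this

lemma comm_rel {i j l : Fin n} (h : i ≠ j) (h' : i ≠ l) (hjl : j ≠ l) (v : F) (Δ : Matrix.SpecialLinearGroup (Fin n) F → Matrix (Fin n) (Fin n) F)
    (hΔ : ∀ g h : Matrix.SpecialLinearGroup (Fin n) F, Δ (g * h) = Δ g * h + g * Δ h) : Δ (SpecialLinearGroup.transvection h v) j i = 0 := by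
  have e : (SpecialLinearGroup.transvection h v : Matrix.SpecialLinearGroup (Fin n) F) * SpecialLinearGroup.transvection h' 1 = SpecialLinearGroup.transvection h' 1 * SpecialLinearGroup.transvection h v := by
    apply Subtype.ext
    rw [Matrix.SpecialLinearGroup.coe_mul, Matrix.SpecialLinearGroup.coe_mul]
    simp only [Matrix.SpecialLinearGroup.transvection_coe, mul_add, add_mul, mul_one, one_mul]
    simp [h.symm, h'.symm]
    abel
  have e2 := congrArg Δ e
  rw [hΔ, hΔ] at e2
  have := congrFun (congrFun e2 j) l
  simp only [Matrix.add_apply, tv_mul_apply, mul_tv_apply] at this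
  simp [h.symm, hjl.symm] at this
  linear_combination this

lemma comm3 {i k j : Fin n} (hik : i ≠ k) (hkj : k ≠ j) (hij : i ≠ j) (Δ : Matrix.SpecialLinearGroup (Fin n) F → Matrix (Fin n) (Fin n) F)
    (hΔ : ∀ g h : Matrix.SpecialLinearGroup (Fin n) F, Δ (g * h) = Δ g * h + g * Δ h) (v : F) :
    Δ (SpecialLinearGroup.transvection hik v) * (SpecialLinearGroup.transvection hkj 1 : Matrix.SpecialLinearGroup (Fin n) F) + (SpecialLinearGroup.transvection hik v : Matrix.SpecialLinearGroup (Fin n) F) * Δ (SpecialLinearGroup.transvection hkj 1) =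
      Δ (SpecialLinearGroup.transvection hij v) * (SpecialLinearGroup.transvection hkj 1 : Matrix.SpecialLinearGroup (Fin n) F) * (SpecialLinearGroup.transvection hik v : Matrix.SpecialLinearGroup (Fin n) F)
      + (SpecialLinearGroup.transvection hij v : Matrix.SpecialLinearGroup (Fin n) F) * Δ (SpecialLinearGroup.transvection hkj 1) * (SpecialLinearGroup.transvection hik v : Matrix.SpecialLinearGroup (Fin n) F)
      + (SpecialLinearGroup.transvection hij v : Matrix.SpecialLinearGroup (Fin n) F) * ((SpecialLinearGroup.transvection hkj 1 : Matrix.SpecialLinearGroup (Fin n) F) * Δ (SpecialLinearGroup.transvection hik v)) := by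
  have e : (SpecialLinearGroup.transvection hik v : Matrix.SpecialLinearGroup (Fin n) F) * SpecialLinearGroup.transvection hkj 1 = SpecialLinearGroup.transvection hij v * SpecialLinearGroup.transvection hkj 1 * SpecialLinearGroup.transvection hik v := by
    apply Subtype.ext
    simp only [Matrix.SpecialLinearGroup.coe_mul]
    simp only [Matrix.SpecialLinearGroup.transvection_coe, mul_add, add_mul, mul_one, one_mul]
    simp [hij.symm, hik.symm, hkj.symm]
    abel
  have e2 := congrArg Δ e
  rw [hΔ, hΔ, hΔ] at e2
  rw [e2, add_mul, Matrix.SpecialLinearGroup.coe_mul, Matrix.mul_assoc _ _ (Δ (SpecialLinearGroup.transvection hik v))]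

lemma exists_third (hn : 2 < n) (i j : Fin n) : ∃ l, i ≠ l ∧ j ≠ l := by
  obtain ⟨l, hl⟩ := Finset.exists_mem_notMem_of_card_lt_card
    (s := {i, j}) (t := (Finset.univ : Finset (Fin n)))
    (lt_of_le_of_lt Finset.card_le_two (by simpa using hn))
  refine ⟨l, ?_⟩
  simp at hl
  exact ⟨Ne.symm hl.1, Ne.symm hl.2⟩

lemma off_zero (hn : 2 < n) (h2 : (2 : F) ≠ 0) (Δ : Matrix.SpecialLinearGroup (Fin n) F → Matrix (Fin n) (Fin n) F)
    (hΔ : ∀ g h : Matrix.SpecialLinearGroup (Fin n) F, Δ (g * h) = Δ g * h + g * Δ h)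
    (h0 : ∀ (i j : Fin n) (hij : i ≠ j) (c : F) (hc : c ≠ 0),
      Δ (SpecialLinearGroup.diag2n hij c hc) = 0)
    {i j : Fin n} (h : i ≠ j) (v : F) (k l : Fin n)
    (hkl : ¬ (k = i ∧ l = j)) : Δ (SpecialLinearGroup.transvection h v) k l = 0 := by
  have hne : (-1 : F) ≠ 1 := by
    intro h; apply h2; linear_combination -h
  -- mixed entries
  have mixed : ∀ {i j : Fin n} (h : i ≠ j) (v : F) (k l : Fin n),
      (k = i ∨ k = j) → l ≠ i → l ≠ j →
      Δ (SpecialLinearGroup.transvection h v) k l = 0 ∧ Δ (SpecialLinearGroup.transvection h v) l k = 0 := by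
    intro i j h v k l hk hi hj
    have R := diag_rel h v v Δ hΔ _ _ (SpecialLinearGroup.diag2n_coe h (-1) (by simp))
      (h0 i j h (-1) (by simp)) (by simp [h.symm, mul_comm])
    have r1 := R k l
    have r2 := R l k
    simp only [hi, hj, if_false] at r1 r2
    have hk' : (if k = i then (-1 : F) else if k = j then (-1)⁻¹ else 1) = -1 := by
      rcases hk with rfl | rfl <;> simp
    rw [hk'] at r1 r2
    constructor
    · have : (2 : F) * Δ (SpecialLinearGroup.transvection h v) k l = 0 := by linear_combination -r1
      simpa [h2] using this
    · have : (2 : F) * Δ (SpecialLinearGroup.transvection h v) l k = 0 := by linear_combination r2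
      simpa [h2] using this
  by_cases hd : k = l
  · subst hd
    -- diagonal entries
    obtain ⟨l, hil, hjl⟩ := exists_third hn i j
    have R := diag_rel h v (-v) Δ hΔ _ _ (SpecialLinearGroup.diag2n_coe hil (-1) (by simp))
      (h0 i l hil (-1) (by simp)) (by simp [h.symm, hjl]) k k
    have hj := comm_rel h hil hjl v Δ hΔ
    have hj' := comm_rel h hil hjl (-v) Δ hΔ
    have hk' : (if k = i then (-1 : F) else if k = l then (-1)⁻¹ else 1) ≠ 0 := by
      split_ifs <;> simp
    rw [mul_comm] at R
    have R := mul_right_cancel₀ hk' R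
    have S := tv_inv_rel h v Δ hΔ k k
    have t1 : (if k = j then (-v) * Δ (SpecialLinearGroup.transvection h v) k i else 0) = 0 := by
      split_ifs with hh
      · subst hh; simp [hj]
      · rfl
    have t2 : (if k = i then v * Δ (SpecialLinearGroup.transvection h (-v)) j k else 0) = 0 := by
      split_ifs with hh
      · subst hh; simp [hj']
      · rfl
    rw [t1, t2, ← R] at S
    have : (2 : F) * Δ (SpecialLinearGroup.transvection h v) k k = 0 := by linear_combination S
    simpa [h2] using this
  by_cases hki : k = i
  · subst hki
    exact (mixed h v k l (Or.inl rfl) (Ne.symm hd) (fun e => hkl ⟨rfl, e⟩)).1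
  by_cases hlj : l = j
  · subst hlj
    exact (mixed h v l k (Or.inr rfl) hki hd).2
  by_cases hkj : k = j
  · subst hkj
    by_cases hli : l = i
    · subst hli
      obtain ⟨m, him, hjm⟩ := exists_third hn l k
      exact comm_rel h him hjm v Δ hΔ
    · exact (mixed h v k l (Or.inr rfl) hli (Ne.symm hd)).1
  by_cases hli : l = i
  · subst hli
    exact (mixed h v l k (Or.inl rfl) hki hkj).2
  -- generic entries
  have C := congrFun (congrFun (comm3 (Ne.symm hli) hlj h Δ hΔ v) k) j
  simp only [Matrix.add_apply, tv_mul_apply, mul_tv_apply] at C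
  have z1 := (mixed (Ne.symm hli) v l k (Or.inr rfl) hki hd).2
  have z2 := (mixed h v j k (Or.inr rfl) hki hkj).2
  simp [hki, hd, Ne.symm hlj, z1, z2] at C
  linear_combination -C

lemma lin (hn : 2 < n) (h2 : (2 : F) ≠ 0) (Δ : Matrix.SpecialLinearGroup (Fin n) F → Matrix (Fin n) (Fin n) F)
    (hΔ : ∀ g h : Matrix.SpecialLinearGroup (Fin n) F, Δ (g * h) = Δ g * h + g * Δ h)
    (h0 : ∀ (i j : Fin n) (hij : i ≠ j) (c : F) (hc : c ≠ 0),
      Δ (SpecialLinearGroup.diag2n hij c hc) = 0)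
    {i j : Fin n} (h : i ≠ j) (v : F) : Δ (SpecialLinearGroup.transvection h v) i j = v * Δ (SpecialLinearGroup.transvection h 1) i j := by
  by_cases hv : v = 0
  · subst hv
    have h1 : Δ 1 = 0 := by
      have := hΔ 1 1
      simpa using this
    simp [h1]
  obtain ⟨l, hil, hjl⟩ := exists_third hn i j
  have R := diag_rel h 1 v Δ hΔ _ _ (SpecialLinearGroup.diag2n_coe hil v hv)
      (h0 i l hil v hv) (by simp [h.symm, hjl]) i j
  simp [h.symm, hjl] at R
  exact R.symm

lemma addrel (hn : 2 < n) (h2 : (2 : F) ≠ 0) (Δ : Matrix.SpecialLinearGroup (Fin n) F → Matrix (Fin n) (Fin n) F)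
    (hΔ : ∀ g h : Matrix.SpecialLinearGroup (Fin n) F, Δ (g * h) = Δ g * h + g * Δ h)
    (h0 : ∀ (i j : Fin n) (hij : i ≠ j) (c : F) (hc : c ≠ 0),
      Δ (SpecialLinearGroup.diag2n hij c hc) = 0)
    {i k j : Fin n} (hik : i ≠ k) (hkj : k ≠ j) (hij : i ≠ j) :
    Δ (SpecialLinearGroup.transvection hij 1) i j = Δ (SpecialLinearGroup.transvection hik 1) i k + Δ (SpecialLinearGroup.transvection hkj 1) k j := by
  have C := congrFun (congrFun (comm3 hik hkj hij Δ hΔ 1) i) j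
  simp only [Matrix.add_apply, tv_mul_apply, mul_tv_apply] at C
  have o := @off_zero n F _ hn h2 Δ hΔ h0
  have a1 := o hik 1 i j (by simp [hkj.symm])
  have a2 := o hkj 1 i j (by simp [hik])
  have a3 := o hij 1 i k (by simp [hkj])
  have a4 := o hkj 1 j j (by simp [hkj.symm])
  have a5 := o hik 1 j j (by simp [hij.symm])
  simp [hik, hkj.symm, hij, a1, a2, a3, a4, a5] at C
  exact C.symm

lemma main_aux (hn : 2 < n) (h2 : (2 : F) ≠ 0) (Δ : Matrix.SpecialLinearGroup (Fin n) F → Matrix (Fin n) (Fin n) F)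
    (hΔ : ∀ g h : Matrix.SpecialLinearGroup (Fin n) F, Δ (g * h) = Δ g * h + g * Δ h)
    (h0 : ∀ (i j : Fin n) (hij : i ≠ j) (c : F) (hc : c ≠ 0),
      Δ (SpecialLinearGroup.diag2n hij c hc) = 0)
    : ∃ m : Matrix (Fin n) (Fin n) F, ∀ g : Matrix.SpecialLinearGroup (Fin n) F, Δ g = m * g - g * m := by
  have o := @off_zero n F _ hn h2 Δ hΔ h0
  have hl := @lin n F _ hn h2 Δ hΔ h0
  have ad := @addrel n F _ hn h2 Δ hΔ h0
  let z : Fin n := ⟨0, by omega⟩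
  have : Nontrivial (Fin n) := Fin.nontrivial_iff_two_le.2 (by omega)
  let d : Fin n → F := fun i => if h : i = z then 0 else Δ (SpecialLinearGroup.transvection h 1) i z
  have neg : ∀ {i j : Fin n} (h : i ≠ j), Δ (SpecialLinearGroup.transvection h 1) i j = - Δ (SpecialLinearGroup.transvection h.symm 1) j i := by
    intro i j h
    obtain ⟨l, hil, hjl⟩ := exists_third hn i j
    have e1 := ad h hjl hil
    have e2 := ad h.symm hil hjl
    linear_combination -e1 - e2
  have hd : ∀ {i j : Fin n} (h : i ≠ j), Δ (SpecialLinearGroup.transvection h 1) i j = d i - d j := by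
    intro i j h
    by_cases hi : i = z
    · subst hi
      simp only [d, dif_pos, dif_neg h.symm, zero_sub]
      exact neg h
    by_cases hj : j = z
    · subst hj
      simp only [d, dif_pos, dif_neg h, sub_zero]
    simp only [d, dif_neg hi, dif_neg hj]
    have := ad h hj hi
    linear_combination -this
  refine ⟨diagonal d, fun g => ?_⟩
  induction g using SpecialLinearGroup.diagonal_transvection_induction' with
  | hdiag i j hij hc =>
    rw [h0, SpecialLinearGroup.diag2n_coe, diagonal_mul_diagonal, diagonal_mul_diagonal]
    simp [mul_comm]
  | htransvec i j hij a =>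
    ext k l
    rw [Matrix.sub_apply, mul_tv_apply, tv_mul_apply]
    by_cases hkl : k = i ∧ l = j
    · obtain ⟨rfl, rfl⟩ := hkl
      rw [hl, hd hij]
      simp
      ring
    · rw [o hij a k l hkl]
      by_cases hk : k = i
      · subst hk
        have : l ≠ j := fun e => hkl ⟨rfl, e⟩
        simp [this, this.symm]
      · simp [hk]
  | hmul A B hA hB =>
    rw [hΔ, hA, hB, Matrix.SpecialLinearGroup.coe_mul]
    noncomm_ring

end aux

theorem torus_aux (p n : ℕ) (hp : p.Prime)
    (Fq : Type) [Field Fq] [Fintype Fq] [CharP Fq p]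
    (δ : SpecialLinearGroup (Fin n) Fq → Matrix (Fin n) (Fin n) Fq)
    (hδ : ∀ g h : SpecialLinearGroup (Fin n) Fq,
      δ (g * h) = δ g + (g : Matrix (Fin n) (Fin n) Fq) * δ h *
        ((g⁻¹ : SpecialLinearGroup (Fin n) Fq) : Matrix (Fin n) (Fin n) Fq)) :
    ∃ m : Matrix (Fin n) (Fin n) Fq, ∀ g : SpecialLinearGroup (Fin n) Fq,
      (∃ D, (g : Matrix (Fin n) (Fin n) Fq) = diagonal D) →
      δ g = m - (g : Matrix (Fin n) (Fin n) Fq) * m *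
        ((g⁻¹ : SpecialLinearGroup (Fin n) Fq) : Matrix (Fin n) (Fin n) Fq) := by
  classical
  let K : Subgroup (Fin n → Fqˣ) :=
    { carrier := {u | ∏ i, u i = 1}
      one_mem' := by simp
      mul_mem' := by
        intro a b ha hb
        simp only [Set.mem_ofPred_eq, Pi.mul_apply, Finset.prod_mul_distrib] at *
        rw [ha, hb, one_mul]
      inv_mem' := by
        intro a ha
        simp only [Set.mem_ofPred_eq, Pi.inv_apply, Finset.prod_inv_distrib] at *
        rw [ha, inv_one] }
  let φ : K → SpecialLinearGroup (Fin n) Fq := fun u =>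
    ⟨diagonal (fun i => (u.1 i : Fq)), by
      rw [det_diagonal]
      have := congrArg (Units.val) u.2
      simpa using this⟩
  have hφ : ∀ u w, φ (u * w) = φ u * φ w := by
    intro u w
    apply Subtype.ext
    rw [Matrix.SpecialLinearGroup.coe_mul]
    simp [φ, diagonal_mul_diagonal]
  have hcardK : (Nat.card K : Fq) ≠ 0 := by
    have hdvd := Subgroup.card_subgroup_dvd_card K
    rw [Nat.card_eq_fintype_card (α := Fin n → Fqˣ), Fintype.card_fun, Fintype.card_units] at hdvd
    intro h
    obtain ⟨c, hc⟩ := hdvd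
    have := congrArg (Nat.cast (R := Fq)) hc
    rw [Nat.cast_mul, h, zero_mul, Nat.cast_pow, Nat.cast_sub Fintype.card_pos] at this
    simp at this
  refine ⟨(Nat.card K : Fq)⁻¹ • ∑ u : K, δ (φ u), ?_⟩
  rintro g ⟨D, hD⟩
  have hdet := g.2
  have hdet : ∏ i, D i = 1 := by
    have := g.2
    rwa [hD, det_diagonal] at this
  have hDi : ∀ i, D i ≠ 0 := by
    intro i hi
    rw [Finset.prod_eq_zero (Finset.mem_univ i) hi] at hdet
    exact zero_ne_one hdet
  obtain ⟨w, rfl⟩ : ∃ w, g = φ w := by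
    refine ⟨⟨fun i => Units.mk0 (D i) (hDi i), ?_⟩, ?_⟩
    · change ∏ i, Units.mk0 (D i) (hDi i) = 1
      ext
      simpa using hdet
    · apply Subtype.ext
      simpa [φ] using hD
  have S : ∑ u : K, δ (φ u) = (Nat.card K : Fq) • δ (φ w) +
      (φ w : Matrix (Fin n) (Fin n) Fq) * (∑ u : K, δ (φ u)) *
        (((φ w)⁻¹ : SpecialLinearGroup (Fin n) Fq) : Matrix (Fin n) (Fin n) Fq) := by
    conv_lhs => rw [← Equiv.sum_comp (Equiv.mulLeft w)]
    simp only [Equiv.coe_mulLeft, hφ, hδ, Finset.sum_add_distrib]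
    rw [Finset.sum_const, Finset.card_univ, ← Nat.card_eq_fintype_card, Nat.cast_smul_eq_nsmul,
      Finset.mul_sum, Finset.sum_mul]
  rw [Matrix.mul_smul, Matrix.smul_mul, ← smul_sub]
  rw [← sub_eq_iff_eq_add] at S
  rw [S, smul_smul, inv_mul_cancel₀ hcardK, one_smul]

theorem h1_SL_gl_eq_zero
    (p q n : ℕ) (hp : p.Prime) (hp2 : 2 < p) (hq : ∃ k : ℕ, 0 < k ∧ q = p ^ k) (hn : 2 < n)
    (Fq : Type) [Field Fq] [Fintype Fq] [CharP Fq p] (hcard : Fintype.card Fq = q)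
    (δ : SpecialLinearGroup (Fin n) Fq → Matrix (Fin n) (Fin n) Fq)
    (hδ : ∀ g h : SpecialLinearGroup (Fin n) Fq,
      δ (g * h) = δ g + (g : Matrix (Fin n) (Fin n) Fq) * δ h *
        ((g⁻¹ : SpecialLinearGroup (Fin n) Fq) : Matrix (Fin n) (Fin n) Fq)) :
    ∃ m : Matrix (Fin n) (Fin n) Fq, ∀ g : SpecialLinearGroup (Fin n) Fq,
      δ g = m - (g : Matrix (Fin n) (Fin n) Fq) * m *
        ((g⁻¹ : SpecialLinearGroup (Fin n) Fq) : Matrix (Fin n) (Fin n) Fq) := by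
  obtain ⟨m₀, hm₀⟩ := torus_aux p n hp Fq δ hδ
  have h2 : (2 : Fq) ≠ 0 := by
    intro h
    have : ((2 : ℕ) : Fq) = 0 := by exact_mod_cast h
    rw [CharP.cast_eq_zero_iff Fq p] at this
    have := Nat.le_of_dvd (by norm_num) this
    omega
  have inv1 : ∀ g : SpecialLinearGroup (Fin n) Fq,
      ((g⁻¹ : SpecialLinearGroup (Fin n) Fq) : Matrix (Fin n) (Fin n) Fq) * g = 1 := by
    intro g
    rw [← Matrix.SpecialLinearGroup.coe_mul, inv_mul_cancel, Matrix.SpecialLinearGroup.coe_one]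
  have inv2 : ∀ g : SpecialLinearGroup (Fin n) Fq,
      (g : Matrix (Fin n) (Fin n) Fq) * (g⁻¹ : SpecialLinearGroup (Fin n) Fq) = 1 := by
    intro g
    rw [← Matrix.SpecialLinearGroup.coe_mul, mul_inv_cancel, Matrix.SpecialLinearGroup.coe_one]
  obtain ⟨m, hm⟩ := main_aux hn h2 (fun g => δ g * g - (m₀ * g - g * m₀)) (by
      intro g h
      rw [hδ, Matrix.SpecialLinearGroup.coe_mul]
      have : (g : Matrix (Fin n) (Fin n) Fq) * δ h *
        ((g⁻¹ : SpecialLinearGroup (Fin n) Fq) : Matrix (Fin n) (Fin n) Fq) * (g * h)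
          = g * δ h * h := by
        rw [← Matrix.mul_assoc, Matrix.mul_assoc _ _ (g : Matrix (Fin n) (Fin n) Fq), inv1,
          Matrix.mul_one]
      rw [add_mul, this]
      noncomm_ring) (by
      intro i j hij c hc
      rw [hm₀ _ ⟨_, SpecialLinearGroup.diag2n_coe hij c hc⟩, sub_mul, Matrix.mul_assoc _ _
        (SpecialLinearGroup.diag2n hij c hc : SpecialLinearGroup (Fin n) Fq).1, inv1,
        Matrix.mul_one, sub_self])
  refine ⟨m₀ + m, fun g => ?_⟩
  have := hm g
  have e : δ g * g = (m₀ + m) * g - g * (m₀ + m) := by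
    rw [sub_eq_iff_eq_add] at this
    rw [this]
    noncomm_ring
  have := congrArg (· * ((g⁻¹ : SpecialLinearGroup (Fin n) Fq) : Matrix (Fin n) (Fin n) Fq)) e
  simp only [sub_mul] at this
  rw [Matrix.mul_assoc, inv2, Matrix.mul_one, Matrix.mul_assoc (m₀ + m), inv2,
    Matrix.mul_one] at this
  exact this
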